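/- Let G be a graph. For any r-form α and s-form β on G, d(α ∧ β) = dα ∧ β + (-1)^r α ∧ dβ. -/

import Mathlib

/-!
Discrete exterior differential calculus on (simple) graphs, following Shi–Yu.

* A tuple of vertices is a *clique tuple* if its entries are pairwise adjacent
  (hence pairwise distinct, since the graph is simple).
* A `k`-tensor is a real function of `k+1` vertex variables vanishing off
  `(k+1)`-cliques; a `k`-form is a skew-symmetric `k`-tensor.
* `tensorProd` is the tensor product, `skewSym` the skew-symmetrization,
  `wedge` the wedge product `α ∧ β = 𝒜(α ⊗ β)`, and `extD` the exterior
  differential.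
-/

open Finset

attribute [local instance] Classical.propDecidable

noncomputable section

variable {V : Type*}

/-- `v₀, …, v_{n-1}` form an `n`-clique of `G` (pairwise adjacent, hence distinct). -/
def IsCliqueTuple (G : SimpleGraph V) {n : ℕ} (v : Fin n → V) : Prop :=
  ∀ i j : Fin n, i ≠ j → G.Adj (v i) (v j)

/-- A `k`-tensor on `G`: a function of `k+1` vertex variables vanishing whenever the
arguments do not form a `(k+1)`-clique. -/
def IsTensor (G : SimpleGraph V) (k : ℕ) (f : (Fin (k + 1) → V) → ℝ) : Prop :=
  ∀ v : Fin (k + 1) → V, ¬ IsCliqueTuple G v → f v = 0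

/-- A `k`-form on `G`: a `k`-tensor that is skew-symmetric in all of its variables. -/
def IsForm (G : SimpleGraph V) (k : ℕ) (f : (Fin (k + 1) → V) → ℝ) : Prop :=
  IsTensor G k f ∧
    ∀ (σ : Equiv.Perm (Fin (k + 1))) (v : Fin (k + 1) → V),
      f (fun i => v (σ i)) = ((Equiv.Perm.sign σ : ℤ) : ℝ) * f v

/-- Tensor product of an `r`-tensor and an `s`-tensor:
`(α ⊗ β)(v₀,…,v_{r+s}) = α(v₀,…,v_r) β(v_r,…,v_{r+s})` on `(r+s+1)`-cliques, `0` otherwise. -/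
def tensorProd (G : SimpleGraph V) (r s : ℕ)
    (α : (Fin (r + 1) → V) → ℝ) (β : (Fin (s + 1) → V) → ℝ) :
    (Fin (r + s + 1) → V) → ℝ :=
  fun v =>
    if IsCliqueTuple G v then
      α (fun i => v (Fin.castLE (by omega) i)) * β (fun i => v ⟨r + i, by omega⟩)
    else 0

/-- Skew-symmetrization of a `k`-tensor:
`𝒜(f)(v₀,…,v_k) = (1/(k+1)!) ∑_{σ ∈ S_{k+1}} sgn σ · f(v_{σ(0)},…,v_{σ(k)})`. -/
def skewSym (k : ℕ) (f : (Fin (k + 1) → V) → ℝ) : (Fin (k + 1) → V) → ℝ :=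
  fun v =>
    ((k + 1).factorial : ℝ)⁻¹ *
      ∑ σ : Equiv.Perm (Fin (k + 1)), ((Equiv.Perm.sign σ : ℤ) : ℝ) * f (fun i => v (σ i))

/-- Wedge product of an `r`-form and an `s`-form: `α ∧ β = 𝒜(α ⊗ β)`. -/
def wedge (G : SimpleGraph V) (r s : ℕ)
    (α : (Fin (r + 1) → V) → ℝ) (β : (Fin (s + 1) → V) → ℝ) :
    (Fin (r + s + 1) → V) → ℝ :=
  skewSym (r + s) (tensorProd G r s α β)

/-- Exterior differential of an `r`-form:
`dα(v₀,…,v_{r+1}) = ∑ᵢ (-1)ⁱ α(v₀,…,v̂ᵢ,…,v_{r+1})` on `(r+2)`-cliques, `0` otherwise.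
For a `0`-form `f` this gives `df(u,v) = f(v) - f(u)` on edges. -/
def extD (G : SimpleGraph V) (r : ℕ) (α : (Fin (r + 1) → V) → ℝ) :
    (Fin (r + 2) → V) → ℝ :=
  fun v =>
    if IsCliqueTuple G v then
      ∑ i : Fin (r + 2), (-1 : ℝ) ^ (i : ℕ) * α (fun j => v (i.succAbove j))
    else 0

/-- Transport a function of `m` vertex variables along an equality `m = n` of arities. -/
def reindex {m n : ℕ} (h : m = n) (f : (Fin m → V) → ℝ) : (Fin n → V) → ℝ :=
  fun v => f (fun i => v (Fin.cast h i))

/-- Wedge product `f ∧ α` of a `0`-form `f : V → ℝ` with a `k`-form `α`,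
reindexed so that the result is again a function of `k+1` vertex variables. -/
def wedge0 (G : SimpleGraph V) (k : ℕ) (f : V → ℝ) (α : (Fin (k + 1) → V) → ℝ) :
    (Fin (k + 1) → V) → ℝ :=
  reindex (by omega) (wedge G 0 k (fun t => f (t 0)) α)

/-- The characteristic `0`-form `χ^v` of a vertex, as a function of one vertex variable. -/
def chi1 (v : V) : (Fin 1 → V) → ℝ := fun t => if t 0 = v then 1 else 0

/-- The `1`-form `dχ^v`. -/
def dchi (G : SimpleGraph V) (v : V) : (Fin 2 → V) → ℝ :=
  extD G 0 (chi1 v)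

/-- The iterated (left-associated) wedge `dχ^{v₁} ∧ dχ^{v₂} ∧ ⋯ ∧ dχ^{v_k}`,
a `k`-form; the empty wedge (`k = 0`) is the constant `1`. -/
def dchiWedge (G : SimpleGraph V) : ∀ k : ℕ, (Fin k → V) → (Fin (k + 1) → V) → ℝ
  | 0, _ => fun _ => 1
  | 1, vs => dchi G (vs 0)
  | (k + 2), vs =>
      wedge G (k + 1) 1 (dchiWedge G (k + 1) (fun i => vs i.castSucc))
        (dchi G (vs (Fin.last (k + 1))))


lemma IsCliqueTuple.comp {G : SimpleGraph V} {m n : ℕ} {v : Fin n → V}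
    (hv : IsCliqueTuple G v) {g : Fin m → Fin n} (hg : Function.Injective g) :
    IsCliqueTuple G (fun i => v (g i)) :=
  fun _ _ hij => hv _ _ fun h => hij (hg h)

lemma IsCliqueTuple.of_perm {G : SimpleGraph V} {n : ℕ} {v : Fin n → V}
    (σ : Equiv.Perm (Fin n)) (hv : IsCliqueTuple G fun i => v (σ i)) : IsCliqueTuple G v := by
  simpa using hv.comp σ.symm.injective

/-- The alternating sum over the faces of a tuple, without the restriction to cliques. -/
def faceSum (k : ℕ) (f : (Fin (k + 1) → V) → ℝ) : (Fin (k + 2) → V) → ℝ :=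
  fun v => ∑ i : Fin (k + 2), (-1 : ℝ) ^ (i : ℕ) * f (fun j => v (i.succAbove j))

lemma reindex_skewSym {m n : ℕ} (h : m = n) (f : (Fin (m + 1) → V) → ℝ) :
    reindex (congrArg (· + 1) h) (skewSym m f) =
      skewSym n (reindex (congrArg (· + 1) h) f) := by
  subst h
  rfl

lemma IsTensor.skewSym {G : SimpleGraph V} {k : ℕ} {f : (Fin (k + 1) → V) → ℝ}
    (hf : IsTensor G k f) : IsTensor G k (skewSym k f) := by
  intro v hv
  have h (σ : Equiv.Perm (Fin (k + 1))) : f (fun i => v (σ i)) = 0 :=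
    hf _ fun h => hv (h.of_perm σ)
  simp [_root_.skewSym, h]

lemma isTensor_tensorProd (G : SimpleGraph V) (r s : ℕ)
    (α : (Fin (r + 1) → V) → ℝ) (β : (Fin (s + 1) → V) → ℝ) :
    IsTensor G (r + s) (tensorProd G r s α β) :=
  fun _ hv => if_neg hv

lemma isTensor_wedge (G : SimpleGraph V) (r s : ℕ)
    (α : (Fin (r + 1) → V) → ℝ) (β : (Fin (s + 1) → V) → ℝ) :
    IsTensor G (r + s) (wedge G r s α β) :=
  (isTensor_tensorProd G r s α β).skewSym

/-- A permutation of `Fin (k + 2)` amounts to the image `j` of `0` together with a permutation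
of the remaining entries, listed increasingly through `j.succAbove`. -/
lemma bijective_cycleRange_mul_decomposeFin (k : ℕ) :
    Function.Bijective fun p : Fin (k + 2) × Equiv.Perm (Fin (k + 1)) =>
      p.1.cycleRange⁻¹ * Equiv.Perm.decomposeFin.symm (0, p.2) := by
  rw [Fintype.bijective_iff_injective_and_card]
  constructor
  · rintro ⟨i, σ⟩ ⟨j, τ⟩ h
    have hij : i = j := by simpa using congrArg (fun e : Equiv.Perm _ => e 0) h
    subst hij
    simpa using h
  · simp [Fintype.card_perm, Nat.factorial_succ]

lemma sum_sign_mul_comp_succ (k : ℕ) (f : (Fin (k + 1) → V) → ℝ) (v : Fin (k + 2) → V) :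
    ∑ τ : Equiv.Perm (Fin (k + 2)), ((Equiv.Perm.sign τ : ℤ) : ℝ) * f (fun j => v (τ j.succ)) =
      ∑ i : Fin (k + 2), (-1 : ℝ) ^ (i : ℕ) *
        ∑ σ : Equiv.Perm (Fin (k + 1)),
          ((Equiv.Perm.sign σ : ℤ) : ℝ) * f (fun j => v (i.succAbove (σ j))) := by
  rw [← (bijective_cycleRange_mul_decomposeFin k).sum_comp, Fintype.sum_prod_type]
  refine sum_congr rfl fun i _ => ?_
  rw [mul_sum]
  refine sum_congr rfl fun σ _ => ?_
  simp [Equiv.Perm.decomposeFin.symm_sign, mul_assoc]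

lemma sum_sign_mul_comp_succAbove (k : ℕ) (f : (Fin (k + 1) → V) → ℝ) (v : Fin (k + 2) → V)
    (i : Fin (k + 2)) :
    ∑ τ : Equiv.Perm (Fin (k + 2)), ((Equiv.Perm.sign τ : ℤ) : ℝ) *
        ((-1 : ℝ) ^ (i : ℕ) * f (fun j => v (τ (i.succAbove j)))) =
      ∑ τ : Equiv.Perm (Fin (k + 2)),
        ((Equiv.Perm.sign τ : ℤ) : ℝ) * f (fun j => v (τ j.succ)) := by
  rw [← Equiv.sum_comp (Equiv.mulRight i.cycleRange)]
  refine sum_congr rfl fun τ _ => ?_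
  have h : ((-1 : ℝ) ^ (i : ℕ)) * (-1) ^ (i : ℕ) = 1 := by rw [← mul_pow]; simp
  simp only [Equiv.coe_mulRight, Equiv.Perm.sign_mul, Fin.sign_cycleRange, Equiv.Perm.mul_apply,
    Fin.cycleRange_succAbove]
  push_cast
  linear_combination ((Equiv.Perm.sign τ : ℤ) : ℝ) * f (fun j => v (τ j.succ)) * h

/-- Skew-symmetrization commutes with the alternating sum over faces. -/
lemma faceSum_skewSym (k : ℕ) (f : (Fin (k + 1) → V) → ℝ) :
    faceSum k (skewSym k f) = skewSym (k + 1) (faceSum k f) := by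
  funext v
  have h : ∑ τ : Equiv.Perm (Fin (k + 2)),
      ((Equiv.Perm.sign τ : ℤ) : ℝ) * faceSum k f (fun i => v (τ i)) =
      ((k + 2 : ℕ) : ℝ) * ∑ τ : Equiv.Perm (Fin (k + 2)),
        ((Equiv.Perm.sign τ : ℤ) : ℝ) * f (fun j => v (τ j.succ)) := by
    simp only [faceSum, mul_sum]
    rw [sum_comm]
    simp only [sum_sign_mul_comp_succAbove, sum_const, card_univ, Fintype.card_fin, nsmul_eq_mul,
      mul_sum]
  rw [skewSym, h, sum_sign_mul_comp_succ, Nat.factorial_succ (k + 1)]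
  simp only [faceSum, skewSym, mul_left_comm _ (((k + 1).factorial : ℝ)⁻¹)]
  rw [← mul_sum]
  have := Nat.factorial_ne_zero (k + 1)
  push_cast
  field_simp
  ring

/-- The Leibniz rule before skew-symmetrization. -/
lemma faceSum_tensorProd (G : SimpleGraph V) (r s : ℕ)
    (α : (Fin (r + 1) → V) → ℝ) (β : (Fin (s + 1) → V) → ℝ)
    {v : Fin (r + s + 2) → V} (hv : IsCliqueTuple G v) :
    faceSum (r + s) (tensorProd G r s α β) v =
      reindex (by omega) (tensorProd G (r + 1) s (extD G r α) β) v +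
        (-1 : ℝ) ^ r * tensorProd G r (s + 1) α (extD G s β) v := by
  have hc : r + 1 + (s + 1) = r + s + 2 := by omega
  have hface (i : Fin (r + s + 2)) : IsCliqueTuple G fun j => v (i.succAbove j) :=
    hv.comp Fin.succAbove_right_injective
  have h₁ : IsCliqueTuple G fun i : Fin (r + 1 + s + 1) => v (Fin.cast (by omega) i) :=
    hv.comp (Fin.cast_injective _)
  have h₂ : IsCliqueTuple G fun i : Fin (r + 2) => v (Fin.castLE (by omega) i) :=
    hv.comp (Fin.castLE_injective _)
  have h₃ : IsCliqueTuple G fun i : Fin (s + 2) => v ⟨r + i, by omega⟩ :=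
    hv.comp fun i j h => by simpa [Fin.ext_iff] using h
  have hlow (i : Fin (r + 1)) :
      tensorProd G r s α β (fun j => v ((Fin.cast hc (Fin.castAdd (s + 1) i)).succAbove j)) =
        α (fun j => v (Fin.castLE (by omega) (i.castSucc.succAbove j))) *
          β (fun j => v ⟨r + 1 + j, by omega⟩) := by
    rw [tensorProd, if_pos (hface _)]
    congr 2 <;> funext j <;> congr 1 <;>
      simp only [Fin.succAbove, Fin.lt_def, Fin.ext_iff] <;> split_ifs <;> simp_all <;> omega
  have hhigh (i : Fin (s + 1)) :
      tensorProd G r s α β (fun j => v ((Fin.cast hc (Fin.natAdd (r + 1) i)).succAbove j)) =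
        α (fun j => v (Fin.castLE (by omega) j)) *
          β (fun j => v ⟨r + i.succ.succAbove j, by omega⟩) := by
    rw [tensorProd, if_pos (hface _)]
    congr 2 <;> funext j <;> congr 1 <;>
      simp only [Fin.succAbove, Fin.lt_def, Fin.ext_iff] <;> split_ifs <;> simp_all <;> omega
  have hL : faceSum (r + s) (tensorProd G r s α β) v =
      (∑ i : Fin (r + 1), (-1 : ℝ) ^ (i : ℕ) *
        α (fun j => v (Fin.castLE (by omega) (i.castSucc.succAbove j)))) *
          β (fun j => v ⟨r + 1 + j, by omega⟩) +
      (-1 : ℝ) ^ (r + 1) * α (fun j => v (Fin.castLE (by omega) j)) *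
        ∑ i : Fin (s + 1), (-1 : ℝ) ^ (i : ℕ) *
          β (fun j => v ⟨r + i.succ.succAbove j, by omega⟩) := by
    rw [faceSum, ← (finCongr hc).sum_comp, Fin.sum_univ_add, sum_mul, mul_sum]
    simp only [finCongr_apply, hlow, hhigh]
    congr 1 <;> refine sum_congr rfl fun i _ => ?_
    · simp [mul_assoc]
    · simp only [Fin.val_cast, Fin.val_natAdd]
      ring
  have hα : extD G r α (fun i => v (Fin.castLE (by omega) i)) =
      (∑ i : Fin (r + 1), (-1 : ℝ) ^ (i : ℕ) *
        α (fun j => v (Fin.castLE (by omega) (i.castSucc.succAbove j)))) +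
      (-1 : ℝ) ^ (r + 1) * α (fun j => v (Fin.castLE (by omega) j)) := by
    rw [extD, if_pos h₂, Fin.sum_univ_castSucc]
    simp only [Fin.succAbove_last, Fin.val_castSucc, Fin.val_last]
    rfl
  have hβ : extD G s β (fun i => v ⟨r + i, by omega⟩) =
      β (fun j => v ⟨r + 1 + j, by omega⟩) +
      -∑ i : Fin (s + 1), (-1 : ℝ) ^ (i : ℕ) *
          β (fun j => v ⟨r + i.succ.succAbove j, by omega⟩) := by
    rw [extD, if_pos h₃, Fin.sum_univ_succ, ← sum_neg_distrib]
    simp only [Fin.succAbove_zero, Fin.val_succ, Fin.val_zero, pow_zero, one_mul, pow_succ]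
    congr 1
    · congr! 3
      simp only [Fin.ext_iff]
      omega
    · refine sum_congr rfl fun i _ => ?_
      ring
  have hR₁ : reindex (by omega) (tensorProd G (r + 1) s (extD G r α) β) v =
      extD G r α (fun i => v (Fin.castLE (by omega) i)) *
        β (fun j => v ⟨r + 1 + j, by omega⟩) := by
    rw [reindex, tensorProd, if_pos h₁]
    rfl
  have hR₂ : tensorProd G r (s + 1) α (extD G s β) v =
      α (fun j => v (Fin.castLE (by omega) j)) *
        extD G s β (fun i => v ⟨r + i, by omega⟩) := by
    rw [tensorProd, if_pos hv]
  rw [hL, hR₁, hR₂, hα, hβ]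
  ring

/-- Graded Leibniz rule: `d(α ∧ β) = dα ∧ β + (-1)^r α ∧ dβ` for an `r`-form `α`
and an `s`-form `β`. -/
theorem extD_wedge (G : SimpleGraph V) (r s : ℕ)
    (α : (Fin (r + 1) → V) → ℝ) (β : (Fin (s + 1) → V) → ℝ)
    (hα : IsForm G r α) (hβ : IsForm G s β) :
    extD G (r + s) (wedge G r s α β) =
      reindex (by omega) (wedge G (r + 1) s (extD G r α) β) +
        (-1 : ℝ) ^ r • wedge G r (s + 1) α (extD G s β) := by
  funext v
  have h : r + 1 + s = r + s + 1 := by omega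
  change _ = reindex _ (wedge G (r + 1) s (extD G r α) β) v +
    (-1 : ℝ) ^ r * wedge G r (s + 1) α (extD G s β) v
  by_cases hv : IsCliqueTuple G v
  · have hL : extD G (r + s) (wedge G r s α β) v = faceSum (r + s) (wedge G r s α β) v :=
      if_pos hv
    have hR : reindex (by omega) (wedge G (r + 1) s (extD G r α) β) v =
        skewSym (r + s + 1)
          (reindex (by omega) (tensorProd G (r + 1) s (extD G r α) β)) v :=
      congrFun (reindex_skewSym h _) v
    rw [hL, hR, wedge, wedge, faceSum_skewSym]
    change _ = _ + (-1 : ℝ) ^ r * skewSym (r + s + 1) _ v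
    simp only [skewSym]
    rw [mul_left_comm, ← mul_add]
    congr 1
    rw [mul_sum, ← sum_add_distrib]
    refine sum_congr rfl fun σ _ => ?_
    rw [faceSum_tensorProd G r s α β (hv.comp σ.injective)]
    ring
  · have hL : extD G (r + s) (wedge G r s α β) v = 0 := if_neg hv
    have hR₁ : reindex (by omega) (wedge G (r + 1) s (extD G r α) β) v = 0 :=
      isTensor_wedge G (r + 1) s _ β _ fun hw => hv <| by
        simpa using hw.comp (Fin.cast_injective (show r + s + 2 = r + 1 + s + 1 by omega))
    rw [hL, hR₁, isTensor_wedge G r (s + 1) α _ v hv]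
    simp

end
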